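/- Suppose U is a Gorenstein bimodule and the injective dimension of U as a right Γ-module equals g. Then for every nonzero M in mod Λ with grade_U M = g, there is an isomorphism M ≅ Ext^g_Γ(Ext^g_Λ(M,U),U). -/

import Mathlib

/-! Common definitions: concrete Ext groups (via the canonical free resolution) of a module
over a ring `R` with coefficients in an `(R,S)`-bimodule `U`, carrying their natural
`S`-module structure; grades, Gorenstein conditions, resolution dimensions, etc. -/

noncomputable section

namespace GorPaper

section Ext

variable (R : Type) [Ring R]

/-- The canonical free cover `R^(M) → M` of a module. -/
def cover (M : Type) [AddCommGroup M] [Module R M] : (M →₀ R) →ₗ[R] M :=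
  Finsupp.linearCombination R (_root_.id : M → M)

/-- The syzygy modules of `M` along its canonical free resolution:
`syz R M 0 = M` and `syz R M (n+1) = ker (R^(syz R M n) → syz R M n)`. -/
def syz (M : ModuleCat.{0} R) : ℕ → ModuleCat.{0} R
  | 0 => M
  | n + 1 => ModuleCat.of R (LinearMap.ker (cover R (syz M n)))

variable {R} in
/-- Functoriality of the free cover. -/
def freeMap {M N : Type} [AddCommGroup M] [Module R M] [AddCommGroup N] [Module R N]
    (f : M →ₗ[R] N) : (M →₀ R) →ₗ[R] (N →₀ R) :=
  Finsupp.lmapDomain R R f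

lemma cover_comp_freeMap {M N : Type} [AddCommGroup M] [Module R M] [AddCommGroup N]
    [Module R N] (f : M →ₗ[R] N) : (cover R N).comp (freeMap f) = f.comp (cover R M) := by
  ext a
  simp [cover, freeMap, Finsupp.linearCombination_single]

lemma freeMap_ker {M N : Type} [AddCommGroup M] [Module R M] [AddCommGroup N] [Module R N]
    (f : M →ₗ[R] N) :
    ∀ x ∈ LinearMap.ker (cover R M), freeMap f x ∈ LinearMap.ker (cover R N) := by
  intro x hx
  have := congrArg (fun g => g x) (cover_comp_freeMap R f)
  simp only [LinearMap.comp_apply] at this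
  simp only [LinearMap.mem_ker] at hx ⊢
  rw [this, hx, map_zero]

variable {R} in
/-- The induced map on first syzygies. -/
def kerMap {M N : Type} [AddCommGroup M] [Module R M] [AddCommGroup N] [Module R N]
    (f : M →ₗ[R] N) :
    ↥(LinearMap.ker (cover R M)) →ₗ[R] ↥(LinearMap.ker (cover R N)) :=
  (freeMap f).restrict (freeMap_ker R f)

variable {R} in
/-- The induced map on `n`-th syzygies. -/
def syzMap {M N : ModuleCat.{0} R} (f : ↥M →ₗ[R] ↥N) :
    ∀ n, ↥(syz R M n) →ₗ[R] ↥(syz R N n)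
  | 0 => f
  | n + 1 => kerMap (syzMap f n)

variable (S : Type) [Ring S]
variable (U : Type) [AddCommGroup U] [Module R U] [Module S U] [SMulCommClass R S U]

/-- Precomposition `Hom_R(B,U) → Hom_R(A,U)`, as an `S`-linear map (where the `S`-module
structures come from the right `S`-structure of the bimodule `U`). -/
def precompS {A B : Type} [AddCommMonoid A] [Module R A] [AddCommMonoid B] [Module R B]
    (t : A →ₗ[R] B) : (B →ₗ[R] U) →ₗ[S] (A →ₗ[R] U) where
  toFun g := g.comp t
  map_add' g h := LinearMap.add_comp _ _ _
  map_smul' s g := LinearMap.smul_comp _ _ _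

/-- The submodule of `Hom_R(Ω N, U)` consisting of those homomorphisms which extend to
the free cover of `N`. -/
def ext1Sub (N : Type) [AddCommGroup N] [Module R N] :
    Submodule S (↥(LinearMap.ker (cover R N)) →ₗ[R] U) :=
  LinearMap.range (precompS R S U (LinearMap.ker (cover R N)).subtype)

/-- `Ext¹_R(N, U)`, as an `S`-module. -/
def Ext1 (N : Type) [AddCommGroup N] [Module R N] : Type :=
  (↥(LinearMap.ker (cover R N)) →ₗ[R] U) ⧸ ext1Sub R S U N

instance (N : Type) [AddCommGroup N] [Module R N] : AddCommGroup (Ext1 R S U N) :=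
  inferInstanceAs (AddCommGroup (_ ⧸ ext1Sub R S U N))

instance (N : Type) [AddCommGroup N] [Module R N] : Module S (Ext1 R S U N) :=
  inferInstanceAs (Module S (_ ⧸ ext1Sub R S U N))

/-- `Ext^n_R(M, U)`, as an `S`-module: `Ext⁰ = Hom_R(M,U)` and
`Ext^{n+1}(M,U) = Ext¹(Ω^n M, U)` (dimension shifting along the canonical free
resolution of `M`). -/
def ExtU (M : ModuleCat.{0} R) : ℕ → Type
  | 0 => ↥M →ₗ[R] U
  | n + 1 => Ext1 R S U ↥(syz R M n)

instance (M : ModuleCat.{0} R) (n : ℕ) : AddCommGroup (ExtU R S U M n) :=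
  match n with
  | 0 => inferInstanceAs (AddCommGroup (↥M →ₗ[R] U))
  | n + 1 => inferInstanceAs (AddCommGroup (Ext1 R S U ↥(syz R M n)))

instance (M : ModuleCat.{0} R) (n : ℕ) : Module S (ExtU R S U M n) :=
  match n with
  | 0 => inferInstanceAs (Module S (↥M →ₗ[R] U))
  | n + 1 => inferInstanceAs (Module S (Ext1 R S U ↥(syz R M n)))

lemma ext1Sub_le_comap {M N : Type} [AddCommGroup M] [Module R M] [AddCommGroup N]
    [Module R N] (f : M →ₗ[R] N) :
    ext1Sub R S U N ≤ (ext1Sub R S U M).comap (precompS R S U (kerMap f)) := by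
  rintro g ⟨h, rfl⟩
  exact ⟨precompS R S U (freeMap f) h, LinearMap.ext fun x => rfl⟩

variable {R} in
/-- Contravariant functoriality of `Ext¹`. -/
def ext1Map {M N : Type} [AddCommGroup M] [Module R M] [AddCommGroup N] [Module R N]
    (f : M →ₗ[R] N) : Ext1 R S U N →ₗ[S] Ext1 R S U M :=
  Submodule.mapQ _ _ (precompS R S U (kerMap f)) (ext1Sub_le_comap R S U f)

variable {R} in
/-- Contravariant functoriality of `Ext^n`: the map
`Ext^n_R(N,U) → Ext^n_R(M,U)` induced by `f : M → N`; it is `S`-linear. -/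
def extMap {M N : ModuleCat.{0} R} (f : ↥M →ₗ[R] ↥N) :
    ∀ n, ExtU R S U N n →ₗ[S] ExtU R S U M n
  | 0 => precompS R S U f
  | n + 1 => ext1Map S U (syzMap f n)

/-- `Ext^n_R(M,U) = 0`. -/
def extVanish (M : ModuleCat.{0} R) (n : ℕ) : Prop :=
  Subsingleton (ExtU R S U M n)

/-- `grade_U M ≥ i` : `Ext^j_R(M,U) = 0` for all `j < i`. -/
def gradeGE (M : ModuleCat.{0} R) (i : ℕ) : Prop :=
  ∀ j < i, extVanish R S U M j

/-- `grade_U M = g` : `grade_U M ≥ g` and `Ext^g_R(M,U) ≠ 0`. -/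
def gradeEq (M : ModuleCat.{0} R) (g : ℕ) : Prop :=
  gradeGE R S U M g ∧ ¬ extVanish R S U M g

/-- `s.grade_U M ≥ i` : `grade_U B ≥ i` for every submodule `B` of `M`. -/
def sgradeGE (M : ModuleCat.{0} R) (i : ℕ) : Prop :=
  ∀ B : Submodule R ↥M, gradeGE R S U (ModuleCat.of R ↥B) i

/-- Membership in `H_g` : `grade_U M = g` and `Ext^i(M,U) = 0` for all `i ≠ g`. -/
def Hmem (M : ModuleCat.{0} R) (g : ℕ) : Prop :=
  gradeEq R S U M g ∧ ∀ i, i ≠ g → extVanish R S U M i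

/-- The functor `Ext^i_S(Ext^i_R(-,U),U) : mod R → mod R` preserves monomorphisms
(on finitely generated modules). -/
def ExtExtMono [SMulCommClass S R U] (i : ℕ) : Prop :=
  ∀ (X Y : ModuleCat.{0} R), Module.Finite R ↥X → Module.Finite R ↥Y →
    ∀ f : ↥X →ₗ[R] ↥Y, Function.Injective f →
      Function.Injective
        (extMap (R := S) (S := R) U
          (M := ModuleCat.of S (ExtU R S U Y i)) (N := ModuleCat.of S (ExtU R S U X i))
          (extMap (S := S) U f i) i)

/-- `M` is `U`-`k`-torsionfree: for (every) finitely generated projective presentation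
`P₁ → P₀ → M → 0`, with `X = coker (Hom(P₀,U) → Hom(P₁,U))`, one has
`Ext^i_S(X, U) = 0` for `1 ≤ i ≤ k`. -/
def Torsionfree [SMulCommClass S R U] (k : ℕ) (M : ModuleCat.{0} R) : Prop :=
  ∀ (P₁ P₀ : ModuleCat.{0} R), Module.Finite R ↥P₁ → Module.Projective R ↥P₁ →
    Module.Finite R ↥P₀ → Module.Projective R ↥P₀ →
    ∀ (f : ↥P₁ →ₗ[R] ↥P₀) (g : ↥P₀ →ₗ[R] ↥M), Function.Surjective g →
      LinearMap.range f = LinearMap.ker g →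
      ∀ i, 1 ≤ i → i ≤ k →
        extVanish S R U
          (ModuleCat.of S ((↥P₁ →ₗ[R] U) ⧸ LinearMap.range (precompS R S U f))) i

end Ext

section Resol

variable (R : Type) [Ring R] (U : Type) [AddCommGroup U] [Module R U]

/-- `A` belongs to `add U`: it is (isomorphic to) a direct summand of a finite direct
sum of copies of `U`. -/
def InAdd (A : ModuleCat.{0} R) : Prop :=
  ∃ (m : ℕ) (i : ↥A →ₗ[R] (Fin m → U)) (p : (Fin m → U) →ₗ[R] ↥A),
    p.comp i = LinearMap.id

/-- `U`-resolution dimension of `A` is at most `n` : there is an exact sequence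
`0 → U_n → ⋯ → U_0 → A → 0` with all `U_i` in `add U`. -/
def URdimLE : ℕ → ModuleCat.{0} R → Prop
  | 0, A => InAdd R U A
  | n + 1, A => ∃ V : ModuleCat.{0} R, InAdd R U V ∧
      ∃ g : ↥V →ₗ[R] ↥A, Function.Surjective g ∧
        URdimLE n (ModuleCat.of R ↥(LinearMap.ker g))

/-- The `U`-resolution dimension of `A`, as an element of `ℕ∞`. -/
def URdim (A : ModuleCat.{0} R) : ℕ∞ :=
  sInf {c : ℕ∞ | ∃ n : ℕ, c = n ∧ URdimLE R U n A}

/-- `M` is a `k`-syzygy module: there is an exact sequence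
`0 → M → P_{k-1} → ⋯ → P_0 → X → 0` with all `P_i` finitely generated projective. -/
def IsSyzygy : ℕ → ModuleCat.{0} R → Prop
  | 0, _ => True
  | k + 1, M => ∃ P : ModuleCat.{0} R, Module.Finite R ↥P ∧ Module.Projective R ↥P ∧
      ∃ f : ↥M →ₗ[R] ↥P, Function.Injective f ∧
        IsSyzygy k (ModuleCat.of R (↥P ⧸ LinearMap.range f))

/-- `M` is a `U`-`k`-syzygy module: there is an exact sequence
`0 → M → X_0 → X_1 → ⋯ → X_{k-1}` with all `X_i` in `add U`. -/
def IsUSyzygy : ℕ → ModuleCat.{0} R → Prop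
  | 0, _ => True
  | k + 1, M => ∃ V : ModuleCat.{0} R, InAdd R U V ∧
      ∃ f : ↥M →ₗ[R] ↥V, Function.Injective f ∧
        IsUSyzygy k (ModuleCat.of R (↥V ⧸ LinearMap.range f))

/-- The injective dimension of `A` is at most `n` : there is an injective resolution
`0 → A → E_0 → ⋯ → E_n → 0`. -/
def injDimLE : ℕ → ModuleCat.{0} R → Prop
  | 0, A => Module.Injective R ↥A
  | n + 1, A => ∃ E : ModuleCat.{0} R, Module.Injective R ↥E ∧
      ∃ f : ↥A →ₗ[R] ↥E, Function.Injective f ∧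
        injDimLE n (ModuleCat.of R (↥E ⧸ LinearMap.range f))

/-- The injective dimension of `A`, as an element of `ℕ∞`. -/
def injDim (A : ModuleCat.{0} R) : ℕ∞ :=
  sInf {c : ℕ∞ | ∃ n : ℕ, c = n ∧ injDimLE R n A}

/-- `A` is a flat `R`-module (equational criterion for flatness, which makes sense
over an arbitrary, possibly noncommutative, ring): every relation in `A` can be
trivialized. -/
def IsFlat (A : Type) [AddCommGroup A] [Module R A] : Prop :=
  ∀ (n : ℕ) (a : Fin n → R) (x : Fin n → A), (∑ i, a i • x i) = 0 →
    ∃ (k : ℕ) (b : Fin n → Fin k → R) (y : Fin k → A),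
      (∀ i, x i = ∑ j, b i j • y j) ∧ ∀ j, (∑ i, a i * b i j) = 0

/-- The flat dimension of `A` is at most `n` : there is a flat resolution
`0 → F_n → ⋯ → F_0 → A → 0`. -/
def flatDimLE : ℕ → ModuleCat.{0} R → Prop
  | 0, A => IsFlat R ↥A
  | n + 1, A => ∃ F : ModuleCat.{0} R, IsFlat R ↥F ∧
      ∃ g : ↥F →ₗ[R] ↥A, Function.Surjective g ∧
        flatDimLE n (ModuleCat.of R ↥(LinearMap.ker g))

/-- `A` is cogenerated by `U` : it embeds into a direct product of copies of `U`. -/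
def Cogenerated (A : ModuleCat.{0} R) : Prop :=
  ∃ (ι : Type) (f : ↥A →ₗ[R] (ι → U)), Function.Injective f

/-- A minimal injective resolution `0 → M → E 0 → E 1 → ⋯` of `M` : an injective
resolution in which the kernel of each differential is an essential submodule. -/
structure MinInjRes (M : Type) [AddCommGroup M] [Module R M] where
  E : ℕ → ModuleCat.{0} R
  injective : ∀ n, Module.Injective R ↥(E n)
  ι : M →ₗ[R] ↥(E 0)
  d : ∀ n, ↥(E n) →ₗ[R] ↥(E (n + 1))
  ι_inj : Function.Injective ι
  exact_zero : LinearMap.ker (d 0) = LinearMap.range ι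
  exact_succ : ∀ n, LinearMap.ker (d (n + 1)) = LinearMap.range (d n)
  essential : ∀ n (B : Submodule R ↥(E n)), B ⊓ LinearMap.ker (d n) = ⊥ → B = ⊥

end Resol

section Bimodule

variable (Λ Γ : Type) [Ring Λ] [Ring Γ]
variable (U : Type) [AddCommGroup U] [Module Λ U] [Module Γᵐᵒᵖ U]
  [SMulCommClass Λ Γᵐᵒᵖ U] [SMulCommClass Γᵐᵒᵖ Λ U]

/-- Left multiplication `u ↦ a • u` as a `Γᵒᵖ`-linear endomorphism of `U`. -/
def lmul (a : Λ) : U →ₗ[Γᵐᵒᵖ] U where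
  toFun u := a • u
  map_add' := smul_add a
  map_smul' γ u := smul_comm a γ u

/-- Right multiplication `u ↦ u γ` as a `Λ`-linear endomorphism of `U`. -/
def rmul (γ : Γᵐᵒᵖ) : U →ₗ[Λ] U where
  toFun u := γ • u
  map_add' := smul_add γ
  map_smul' a u := smul_comm γ a u

/-- `U` is a faithfully balanced `(Λ,Γ)`-bimodule: the natural maps
`Λ → End(U_Γ)` and `Γ → End(_ΛU)^op` are isomorphisms. -/
def FaithfullyBalanced : Prop :=
  Function.Bijective (lmul Λ Γ U) ∧ Function.Bijective (rmul Λ Γ U)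

/-- `U` is selforthogonal: `Ext^i_Λ(U,U) = 0 = Ext^i_Γ(U,U)` for all `i ≥ 1`. -/
def SelfOrthogonal : Prop :=
  (∀ i, 1 ≤ i → extVanish Λ Γᵐᵒᵖ U (ModuleCat.of Λ U) i) ∧
  (∀ i, 1 ≤ i → extVanish Γᵐᵒᵖ Λ U (ModuleCat.of Γᵐᵒᵖ U) i)

/-- `_ΛU` is `k`-Gorenstein : `s.grade_U Ext^i_Γ(N,U) ≥ i` for every
`N ∈ mod Γᵒᵖ` and all `1 ≤ i ≤ k`. -/
def LeftGorenstein (k : ℕ) : Prop :=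
  ∀ N : ModuleCat.{0} Γᵐᵒᵖ, Module.Finite Γᵐᵒᵖ ↥N →
    ∀ i, 1 ≤ i → i ≤ k →
      sgradeGE Λ Γᵐᵒᵖ U (ModuleCat.of Λ (ExtU Γᵐᵒᵖ Λ U N i)) i

/-- `U_Γ` is `k`-Gorenstein : `s.grade_U Ext^i_Λ(M,U) ≥ i` for every
`M ∈ mod Λ` and all `1 ≤ i ≤ k`. -/
def RightGorenstein (k : ℕ) : Prop :=
  ∀ M : ModuleCat.{0} Λ, Module.Finite Λ ↥M →
    ∀ i, 1 ≤ i → i ≤ k →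
      sgradeGE Γᵐᵒᵖ Λ U (ModuleCat.of Γᵐᵒᵖ (ExtU Λ Γᵐᵒᵖ U M i)) i

end Bimodule

section Bridge

open CategoryTheory

variable (R : Type) [Ring R] (S : Type) [Ring S]
variable (U : Type) [AddCommGroup U] [Module R U] [Module S U] [SMulCommClass R S U]

/-- Mathlib's `Ext` with coefficients in `U`. -/
abbrev EE (M : ModuleCat.{0} R) (n : ℕ) : Type := Abelian.Ext.{0} M (ModuleCat.of R U) n

/-- The action of `s` on `U` as a morphism. -/
def smulHom (s : S) : ModuleCat.of R U ⟶ ModuleCat.of R U :=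
  ModuleCat.ofHom (s • (LinearMap.id : U →ₗ[R] U))

/-- The action of `s` on `Ext`. -/
def actE (M : ModuleCat.{0} R) (n : ℕ) (s : S) (x : Abelian.Ext.{0} M (ModuleCat.of R U) n) :
    Abelian.Ext.{0} M (ModuleCat.of R U) n :=
  x.comp (Abelian.Ext.mk₀ (smulHom R S U s)) (add_zero n)

instance (M : ModuleCat.{0} R) (n : ℕ) : Module S (EE R U M n) where
  smul s x := actE R S U M n s x
  one_smul x := by
    change actE R S U M n 1 x = x
    have : smulHom R S U 1 = 𝟙 _ := by ext; simp [smulHom]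
    rw [actE, this, Abelian.Ext.comp_mk₀_id]
  mul_smul s t x := by
    change actE R S U M n (s * t) x = actE R S U M n s (actE R S U M n t x)
    have : smulHom R S U (s * t) = smulHom R S U t ≫ smulHom R S U s := by
      ext; simp [smulHom, mul_smul]
    rw [actE, actE, actE, this, ← Abelian.Ext.mk₀_comp_mk₀,
      Abelian.Ext.comp_assoc_of_third_deg_zero]
  smul_zero s := by
    change actE R S U M n s 0 = 0
    simp [actE]
  smul_add s x y := by
    change actE R S U M n s (x + y) = actE R S U M n s x + actE R S U M n s y
    simp [actE]
  add_smul s t x := by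
    change actE R S U M n (s + t) x = actE R S U M n s x + actE R S U M n t x
    have : smulHom R S U (s + t) = smulHom R S U s + smulHom R S U t := by
      ext; simp [smulHom, add_smul]
    rw [actE, actE, actE, this, Abelian.Ext.mk₀_add, Abelian.Ext.comp_add]
  zero_smul x := by
    change actE R S U M n 0 x = 0
    have : smulHom R S U 0 = 0 := by ext; simp [smulHom]
    rw [actE, this, Abelian.Ext.mk₀_zero, Abelian.Ext.comp_zero]

lemma EE_smul_def (M : ModuleCat.{0} R) (n : ℕ) (s : S) (x : EE R U M n) :
    s • x = actE R S U M n s x := rfl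

/-- `Hom_R(M,U) = Ext⁰`. -/
def homEE (M : ModuleCat.{0} R) : (↥M →ₗ[R] U) ≃ₗ[S] EE R U M 0 where
  toFun f := Abelian.Ext.mk₀ (ModuleCat.ofHom f)
  invFun x := (Abelian.Ext.homEquiv₀ x).hom
  left_inv f := by
    have := (Abelian.Ext.homEquiv₀ (C := ModuleCat.{0} R)).apply_symm_apply
      (ModuleCat.ofHom f : M ⟶ ModuleCat.of R U)
    exact congrArg ModuleCat.Hom.hom this
  right_inv x := by
    exact Abelian.Ext.mk₀_homEquiv₀_apply x
  map_add' f g := Abelian.Ext.mk₀_add (ModuleCat.ofHom f) (ModuleCat.ofHom g)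
  map_smul' s f := by
    rw [RingHom.id_apply, EE_smul_def, actE, Abelian.Ext.mk₀_comp_mk₀]
    rfl

/-- precomposition -/
def preEE {A B : ModuleCat.{0} R} (f : ↥A →ₗ[R] ↥B) (n : ℕ) : EE R U B n →ₗ[S] EE R U A n where
  toFun x := (Abelian.Ext.mk₀ (ModuleCat.ofHom f)).comp x (zero_add n)
  map_add' x y := Abelian.Ext.comp_add _ _ _ _
  map_smul' s x := by
    rw [RingHom.id_apply, EE_smul_def, EE_smul_def, actE, actE]
    rw [Abelian.Ext.comp_assoc_of_third_deg_zero]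

lemma preEE_homEE {A B : ModuleCat.{0} R} (f : ↥A →ₗ[R] ↥B) (h : ↥B →ₗ[R] U) :
    preEE R S U f 0 (homEE R S U B h) = homEE R S U A (h.comp f) := by
  change (Abelian.Ext.mk₀ _).comp (Abelian.Ext.mk₀ _) (zero_add 0) = Abelian.Ext.mk₀ _
  rw [Abelian.Ext.mk₀_comp_mk₀]
  rfl

/-- An isomorphism induces an isomorphism on `Ext`. -/
def isoEE {A B : ModuleCat.{0} R} (e : ↥A ≃ₗ[R] ↥B) (n : ℕ) : EE R U B n ≃ₗ[S] EE R U A n :=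
  LinearEquiv.ofLinearMap (preEE R S U e.toLinearMap n) (preEE R S U e.symm.toLinearMap n)
    (by
      ext x
      change (Abelian.Ext.mk₀ _).comp ((Abelian.Ext.mk₀ _).comp x (zero_add n)) (zero_add n) = x
      rw [Abelian.Ext.mk₀_comp_mk₀_assoc, ← ModuleCat.ofHom_comp, LinearEquiv.symm_comp]
      exact Abelian.Ext.mk₀_id_comp _)
    (by
      ext x
      change (Abelian.Ext.mk₀ _).comp ((Abelian.Ext.mk₀ _).comp x (zero_add n)) (zero_add n) = x
      rw [Abelian.Ext.mk₀_comp_mk₀_assoc, ← ModuleCat.ofHom_comp, LinearEquiv.comp_symm]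
      exact Abelian.Ext.mk₀_id_comp _)

variable {R} in
/-- the short complex of a short exact sequence -/
def mkSC {A B C : ModuleCat.{0} R} (f : ↥A →ₗ[R] ↥B) (g : ↥B →ₗ[R] ↥C)
    (hfg : Function.Exact f g) : ShortComplex (ModuleCat.{0} R) :=
  ShortComplex.mk (ModuleCat.ofHom f) (ModuleCat.ofHom g) (by
    ext x; exact hfg.apply_apply_eq_zero x)

variable {R} in
lemma mkSC_shortExact {A B C : ModuleCat.{0} R} (f : ↥A →ₗ[R] ↥B) (g : ↥B →ₗ[R] ↥C)
    (hf : Function.Injective f) (hfg : Function.Exact f g) (hg : Function.Surjective g) :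
    (mkSC f g hfg).ShortExact := by
  have h1 : Mono (mkSC f g hfg).f := (ModuleCat.mono_iff_injective _).2 hf
  have h2 : Epi (mkSC f g hfg).g := (ModuleCat.epi_iff_surjective _).2 hg
  refine ⟨?_⟩
  rw [ShortComplex.ShortExact.moduleCat_exact_iff_function_exact]
  exact hfg

section SES

variable {R}
variable {A B C : ModuleCat.{0} R} (f : ↥A →ₗ[R] ↥B) (g : ↥B →ₗ[R] ↥C)
    (hf : Function.Injective f) (hfg : Function.Exact f g) (hg : Function.Surjective g)

/-- connecting map -/
def deltaEE (n : ℕ) : EE R U A n →ₗ[S] EE R U C (n + 1) where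
  toFun x := (mkSC_shortExact f g hf hfg hg).extClass.comp x (add_comm 1 n)
  map_add' x y := Abelian.Ext.comp_add _ _ _ _
  map_smul' s x := by
    exact (Abelian.Ext.comp_assoc_of_third_deg_zero _ _ _ _).symm

include hf hg in
lemma exactA {n : ℕ} (x : EE R U A n) (hx : deltaEE S U f g hf hfg hg n x = 0) :
    ∃ y, preEE R S U f n y = x :=
  Abelian.Ext.contravariant_sequence_exact₁ (mkSC_shortExact f g hf hfg hg) _ x (add_comm 1 n) hx

include hf hfg hg in
lemma exactB {n : ℕ} (x : EE R U B n) (hx : preEE R S U f n x = 0) :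
    ∃ y, preEE R S U g n y = x :=
  Abelian.Ext.contravariant_sequence_exact₂ (mkSC_shortExact f g hf hfg hg) _ x hx

lemma exactC {n : ℕ} (x : EE R U C (n + 1)) (hx : preEE R S U g (n + 1) x = 0) :
    ∃ y, deltaEE S U f g hf hfg hg n y = x :=
  Abelian.Ext.contravariant_sequence_exact₃ (mkSC_shortExact f g hf hfg hg) _ x hx (add_comm 1 n)

lemma delta_pre {n : ℕ} (x : EE R U B n) :
    deltaEE S U f g hf hfg hg n (preEE R S U f n x) = 0 :=
  (mkSC_shortExact f g hf hfg hg).extClass_comp_assoc _ (h := add_comm 1 n)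

include hf hfg hg

lemma shiftIso {n : ℕ} (h1 : Subsingleton (EE R U B n)) (h2 : Subsingleton (EE R U B (n + 1))) :
    Nonempty (EE R U A n ≃ₗ[S] EE R U C (n + 1)) := by
  refine ⟨LinearEquiv.ofBijective (deltaEE S U f g hf hfg hg n) ⟨?_, ?_⟩⟩
  · rw [← LinearMap.ker_eq_bot, LinearMap.ker_eq_bot']
    intro x hx
    obtain ⟨y, rfl⟩ := exactA S U f g hf hfg hg x hx
    rw [Subsingleton.elim y 0, map_zero]
  · intro x
    exact exactC S U f g hf hfg hg x (Subsingleton.elim _ _)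

lemma vanishA {n : ℕ} (h1 : Subsingleton (EE R U B n)) (h2 : Subsingleton (EE R U C (n + 1))) :
    Subsingleton (EE R U A n) := by
  refine subsingleton_of_forall_eq 0 fun x => ?_
  obtain ⟨y, rfl⟩ := exactA ℤ U f g hf hfg hg x (Subsingleton.elim _ _)
  rw [Subsingleton.elim y 0, map_zero]

lemma extendHom (h2 : Subsingleton (EE R U C 1)) (k : ↥A →ₗ[R] U) :
    ∃ h : ↥B →ₗ[R] U, h.comp f = k := by
  obtain ⟨y, hy⟩ := exactA ℤ U f g hf hfg hg (homEE R ℤ U A k)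
    (Subsingleton.elim (α := EE R U C 1) _ _)
  obtain ⟨h, rfl⟩ := (homEE R ℤ U B).surjective y
  rw [preEE_homEE] at hy
  exact ⟨h, (homEE R ℤ U A).injective hy⟩

lemma shift0 (h1 : Subsingleton (EE R U B 1)) :
    Nonempty (((↥A →ₗ[R] U) ⧸ LinearMap.range (precompS R S U f)) ≃ₗ[S] EE R U C 1) := by
  let φ : (↥A →ₗ[R] U) →ₗ[S] EE R U C 1 :=
    (deltaEE S U f g hf hfg hg 0).comp (homEE R S U A).toLinearMap
  have hk : LinearMap.ker φ = LinearMap.range (precompS R S U f) := by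
    ext k
    rw [LinearMap.mem_ker, LinearMap.mem_range]
    constructor
    · intro hx
      obtain ⟨y, hy⟩ := exactA S U f g hf hfg hg (homEE R S U A k) hx
      obtain ⟨h, rfl⟩ := (homEE R S U B).surjective y
      rw [preEE_homEE] at hy
      exact ⟨h, (homEE R S U A).injective hy⟩
    · rintro ⟨h, rfl⟩
      have := delta_pre S U f g hf hfg hg (homEE R S U B h)
      rw [preEE_homEE] at this
      exact this
  have hs : Function.Surjective φ := by
    intro x
    obtain ⟨y, rfl⟩ := exactC S U f g hf hfg hg x (Subsingleton.elim _ _)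
    obtain ⟨h, rfl⟩ := (homEE R S U A).surjective y
    exact ⟨h, rfl⟩
  exact ⟨(Submodule.quotEquivOfEq _ _ hk.symm).trans (φ.quotKerEquivOfSurjective hs)⟩

end SES

lemma vanish_proj (P : ModuleCat.{0} R) [Module.Projective R ↥P] (n : ℕ) :
    Subsingleton (EE R U P (n + 1)) := by
  have : Projective P := inferInstance
  exact Abelian.Ext.subsingleton_of_projective P _ n

lemma vanish_retract {A : ModuleCat.{0} R} {n : ℕ} (h : Subsingleton (EE R U A n)) {m : ℕ}
    {B : ModuleCat.{0} R} (i : Fin m → (↥A →ₗ[R] ↥B)) (p : Fin m → (↥B →ₗ[R] ↥A))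
    (hip : ∑ k, (i k).comp (p k) = LinearMap.id) : Subsingleton (EE R U B n) := by
  refine subsingleton_of_forall_eq 0 fun x => ?_
  have h1 : (𝟙 B : B ⟶ B) = ∑ k, ModuleCat.ofHom (p k) ≫ ModuleCat.ofHom (i k) := by
    ext x
    have := congrArg (fun g => g x) hip
    simp at this
    simp [ModuleCat.hom_sum, this]
  rw [← Abelian.Ext.mk₀_id_comp x, h1, Abelian.Ext.mk₀_sum, Abelian.Ext.sum_comp]
  refine Finset.sum_eq_zero fun k _ => ?_
  rw [← Abelian.Ext.mk₀_comp_mk₀_assoc]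
  have : (Abelian.Ext.mk₀ (ModuleCat.ofHom (i k))).comp x (zero_add n) = (0 : EE R U A n) :=
    Subsingleton.elim _ _
  rw [this, Abelian.Ext.comp_zero]

lemma injDimLE_hasInj (n : ℕ) : ∀ (A : ModuleCat.{0} R), injDimLE R n A →
    HasInjectiveDimensionLT A (n + 1) := by
  induction n with
  | zero =>
    intro A hA
    have : Module.Injective R ↥A := hA
    have : Injective (ModuleCat.of R ↥A) := Module.injective_object_of_injective_module (inj := this)
    have : Injective A := this
    infer_instance
  | succ n ih =>
    rintro A ⟨E, hE, f, hf, hq⟩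
    have : Module.Injective R ↥E := hE
    have : Injective (ModuleCat.of R ↥E) := Module.injective_object_of_injective_module (inj := this)
    have : Injective E := this
    have hex : Function.Exact f (LinearMap.range f).mkQ := by
      intro x; simp
    have hS := mkSC_shortExact (A := A) (B := E) (C := ModuleCat.of R (↥E ⧸ LinearMap.range f))
      f (LinearMap.range f).mkQ hf hex (Submodule.mkQ_surjective _)
    have h2 : HasInjectiveDimensionLT E (n + 1 + 1) := inferInstance
    exact hS.hasInjectiveDimensionLT_X₁ (n + 1) (ih _ hq) h2

lemma vanish_injDim {n : ℕ} (h : injDimLE R n (ModuleCat.of R U)) (N : ModuleCat.{0} R) (i : ℕ)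
    (hi : n < i) : Subsingleton (EE R U N i) := by
  have := injDimLE_hasInj R n _ h
  exact HasInjectiveDimensionLT.subsingleton (ModuleCat.of R U) (n + 1) i hi N

lemma cover_surj (N : Type) [AddCommGroup N] [Module R N] : Function.Surjective (cover R N) := by
  intro x
  exact ⟨Finsupp.single x 1, by simp [cover]⟩

lemma syz_iso (M : ModuleCat.{0} R) (n i : ℕ) :
    Nonempty (EE R U (syz R M n) (i + 1) ≃ₗ[S] EE R U M (i + 1 + n)) := by
  induction n generalizing i with
  | zero => exact ⟨LinearEquiv.refl _ _⟩
  | succ n ih =>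
    obtain ⟨e⟩ := ih (i + 1)
    have hp : Module.Projective R (↥(syz R M n) →₀ R) := inferInstance
    obtain ⟨e'⟩ := shiftIso S U (A := syz R M (n + 1)) (B := ModuleCat.of R (↥(syz R M n) →₀ R))
      (C := syz R M n) (LinearMap.ker (cover R (syz R M n))).subtype (cover R (syz R M n))
      (Submodule.subtype_injective _) (LinearMap.exact_subtype_ker_map _) (cover_surj R _)
      (n := i + 1) (vanish_proj R U _ _) (vanish_proj R U _ _)
    have h3 : i + 1 + 1 + n = i + 1 + (n + 1) := by omega
    rw [← h3]
    exact ⟨e'.trans e⟩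

lemma bridge (M : ModuleCat.{0} R) (n : ℕ) : Nonempty (ExtU R S U M n ≃ₗ[S] EE R U M n) := by
  cases n with
  | zero => exact ⟨homEE R S U M⟩
  | succ n =>
    obtain ⟨e⟩ := syz_iso R S U M n 0
    obtain ⟨e'⟩ := shift0 S U (A := syz R M (n + 1)) (B := ModuleCat.of R (↥(syz R M n) →₀ R))
      (C := syz R M n) (LinearMap.ker (cover R (syz R M n))).subtype (cover R (syz R M n))
      (Submodule.subtype_injective _) (LinearMap.exact_subtype_ker_map _) (cover_surj R _)
      (vanish_proj R U _ _)
    have h3 : 0 + 1 + n = n + 1 := by omega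
    rw [h3] at e
    exact ⟨(e'.trans e : (_ ⧸ ext1Sub R S U ↥(syz R M n)) ≃ₗ[S] _)⟩

end Bridge

section Main

variable (R : Type) [Ring R] (S : Type) [Ring S]
variable (U : Type) [AddCommGroup U] [Module R U] [Module S U] [SMulCommClass R S U]
  [SMulCommClass S R U]

/-- Existence of a resolution by finitely generated free modules. -/
lemma exists_res [IsNoetherianRing R] (M : ModuleCat.{0} R) (hM : Module.Finite R ↥M) :
    ∃ (K : ℕ → ModuleCat.{0} R) (m : ℕ → ℕ) (p : ∀ n, (Fin (m n) → R) →ₗ[R] ↥(K n))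
      (i : ∀ n, ↥(K (n + 1)) →ₗ[R] (Fin (m n) → R)), K 0 = M ∧
      (∀ n, Function.Injective (i n)) ∧ (∀ n, Function.Exact (i n) (p n)) ∧
      (∀ n, Function.Surjective (p n)) := by
  have hc : ∀ N : {N : ModuleCat.{0} R // Module.Finite R ↥N},
      ∃ (m : ℕ) (p : (Fin m → R) →ₗ[R] ↥N.1), Function.Surjective p := fun N => by
    have := N.2
    exact Module.Finite.exists_fin' R ↥N.1
  choose rk cv hcv using hc
  let nxt : {N : ModuleCat.{0} R // Module.Finite R ↥N} →
      {N : ModuleCat.{0} R // Module.Finite R ↥N} := fun N =>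
    ⟨ModuleCat.of R ↥(LinearMap.ker (cv N)), inferInstanceAs (Module.Finite R ↥(LinearMap.ker (cv N)))⟩
  let K : ℕ → {N : ModuleCat.{0} R // Module.Finite R ↥N} := fun n =>
    Nat.rec ⟨M, hM⟩ (fun _ N => nxt N) n
  refine ⟨fun n => (K n).1, fun n => rk (K n), fun n => cv (K n),
    fun n => (LinearMap.ker (cv (K n))).subtype, rfl, fun n => ?_, fun n => ?_, fun n => hcv _⟩
  · exact Submodule.subtype_injective _
  · exact LinearMap.exact_subtype_ker_map _

/-- The evaluation map into the double dual. -/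
def evd (P : Type) [AddCommGroup P] [Module R P] : P →ₗ[R] ((P →ₗ[R] U) →ₗ[S] U) where
  toFun x :=
    { toFun := fun f => f x
      map_add' := fun _ _ => rfl
      map_smul' := fun _ _ => rfl }
  map_add' x y := by ext f; exact map_add f x y
  map_smul' r x := by ext f; exact map_smul f r x

/-- `u ↦ (x ↦ x k • u)`. -/
def coordS {m : ℕ} (k : Fin m) : U →ₗ[S] ((Fin m → R) →ₗ[R] U) where
  toFun u := (LinearMap.toSpanSingleton R U u).comp (LinearMap.proj k)
  map_add' u v := by ext; simp
  map_smul' s u := by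
    refine LinearMap.ext fun x => ?_
    change x k • s • u = s • x k • u
    exact smul_comm _ _ _

/-- `f ↦ f (e k)`. -/
def coordP {m : ℕ} (k : Fin m) : ((Fin m → R) →ₗ[R] U) →ₗ[S] U where
  toFun f := f (Pi.single k 1)
  map_add' _ _ := rfl
  map_smul' _ _ := rfl

lemma coord_sum (m : ℕ) :
    ∑ k : Fin m, (coordS R S U k).comp (coordP R S U k) = LinearMap.id := by
  refine LinearMap.ext fun f => LinearMap.ext fun x => ?_
  have hx : x = ∑ k, x k • (Pi.single k (1 : R) : Fin m → R) := by
    ext j; simp [Finset.sum_apply, Pi.single_apply]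
  conv_rhs => rw [LinearMap.id_apply, hx, map_sum]
  simp [coordS, coordP, LinearMap.sum_apply]

lemma evd_bijective (hb1 : ∀ φ : U →ₗ[S] U, ∃ a : R, ∀ u, φ u = a • u)
    (hb2 : ∀ a : R, (∀ u : U, a • u = 0) → a = 0) (m : ℕ) :
    Function.Bijective (evd R S U (Fin m → R)) := by
  constructor
  · rw [← LinearMap.ker_eq_bot, LinearMap.ker_eq_bot']
    intro x hx
    ext k
    refine hb2 _ fun u => ?_
    have := congrArg (fun g => g (coordS R S U k u)) hx
    simpa [evd, coordS] using this
  · intro ψ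
    choose a ha using fun k : Fin m => hb1 (ψ.comp (coordS R S U k))
    refine ⟨a, LinearMap.ext fun f => ?_⟩
    have hx : a = ∑ k, a k • (Pi.single k (1 : R) : Fin m → R) := by
      ext j; simp [Finset.sum_apply, Pi.single_apply]
    have h1 : f = ∑ k : Fin m, coordS R S U k (coordP R S U k f) := by
      have := congrArg (fun g => g f) (coord_sum R S U m)
      simpa [LinearMap.sum_apply] using this.symm
    change f a = ψ f
    conv_rhs => rw [h1, map_sum]
    conv_lhs => rw [hx, map_sum]
    refine Finset.sum_congr rfl fun k _ => ?_
    rw [map_smul]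
    exact (ha k (coordP R S U k f)).symm

lemma vanish_dual (hso : ∀ i, Subsingleton (EE S U (ModuleCat.of S U) (i + 1))) (m i : ℕ) :
    Subsingleton (EE S U (ModuleCat.of S ((Fin m → R) →ₗ[R] U)) (i + 1)) :=
  vanish_retract S U (A := ModuleCat.of S U) (B := ModuleCat.of S ((Fin m → R) →ₗ[R] U)) (hso i)
    (fun k => coordS R S U k) (fun k => coordP R S U k) (coord_sum R S U m)

/-- Recognition of `M` as the cokernel of the double dual of a presentation. -/
lemma recog (hb1 : ∀ φ : U →ₗ[S] U, ∃ a : R, ∀ u, φ u = a • u)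
    (hb2 : ∀ a : R, (∀ u : U, a • u = 0) → a = 0) {m₀ m₁ : ℕ}
    {M : Type} [AddCommGroup M] [Module R M] (d : (Fin m₁ → R) →ₗ[R] (Fin m₀ → R))
    (p : (Fin m₀ → R) →ₗ[R] M) (hdp : Function.Exact d p) (hp : Function.Surjective p)
    {A : Type} [AddCommGroup A] [Module S A] (e : ((Fin m₀ → R) →ₗ[R] U) ≃ₗ[S] A)
    {X : Type} [AddCommGroup X] [Module R X] (ψ : (A →ₗ[S] U) →ₗ[R] X)
    (hψ : Function.Surjective ψ)
    (hk : ∀ h, ψ h = 0 ↔ ∃ k : ((Fin m₁ → R) →ₗ[R] U) →ₗ[S] U,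
      ∀ f, k (precompS R S U d f) = h (e f)) :
    Nonempty (M ≃ₗ[R] X) := by
  obtain ⟨ei, es⟩ := evd_bijective R S U hb1 hb2 m₀
  let Φ : (Fin m₀ → R) →ₗ[R] X :=
    ψ.comp ((precompS S R U e.symm.toLinearMap).comp (evd R S U (Fin m₀ → R)))
  have hs : Function.Surjective Φ := by
    intro x
    obtain ⟨h, rfl⟩ := hψ x
    obtain ⟨y, hy⟩ := es (h.comp e.toLinearMap)
    refine ⟨y, ?_⟩
    change ψ ((evd R S U (Fin m₀ → R) y).comp e.symm.toLinearMap) = ψ h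
    rw [hy]
    congr 1
    ext a
    simp
  have hker : LinearMap.ker p = LinearMap.ker Φ := by
    ext x
    have h2 : x ∈ LinearMap.ker Φ ↔ ∃ k : ((Fin m₁ → R) →ₗ[R] U) →ₗ[S] U,
        ∀ f, k (precompS R S U d f) = f x := by
      rw [LinearMap.mem_ker]
      refine (hk _).trans (exists_congr fun k => forall_congr' fun f => ?_)
      have : (precompS S R U e.symm.toLinearMap) (evd R S U (Fin m₀ → R) x) (e f) = f x := by
        change (e.symm (e f)) x = f x
        rw [e.symm_apply_apply]
      exact Eq.congr_right this
    rw [h2, LinearMap.mem_ker]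
    constructor
    · intro hx
      obtain ⟨y, rfl⟩ := (hdp x).1 hx
      exact ⟨evd R S U _ y, fun f => rfl⟩
    · rintro ⟨k, hk⟩
      obtain ⟨y, rfl⟩ := (evd_bijective R S U hb1 hb2 m₁).2 k
      have : d y = x := ei (LinearMap.ext fun f => hk f)
      rw [← this]
      exact hdp.apply_apply_eq_zero y
  exact ⟨(p.quotKerEquivOfSurjective hp).symm.trans
    ((Submodule.quotEquivOfEq _ _ hker).trans (Φ.quotKerEquivOfSurjective hs))⟩

lemma precompS_injective {A B : Type} [AddCommGroup A] [Module R A] [AddCommGroup B] [Module R B]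
    (t : A →ₗ[R] B) (ht : Function.Surjective t) : Function.Injective (precompS R S U t) := by
  intro f g h
  refine LinearMap.ext fun x => ?_
  obtain ⟨y, rfl⟩ := ht x
  exact congrArg (fun k => k y) h

lemma precompS_exact {A B C : Type} [AddCommGroup A] [Module R A] [AddCommGroup B] [Module R B]
    [AddCommGroup C] [Module R C] (f : A →ₗ[R] B) (g : B →ₗ[R] C) (hfg : Function.Exact f g)
    (hg : Function.Surjective g) :
    Function.Exact (precompS R S U g) (precompS R S U f) := by
  intro h
  constructor
  · intro hh
    have hle : LinearMap.ker g ≤ LinearMap.ker h := by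
      intro x hx
      obtain ⟨y, rfl⟩ := (hfg x).1 hx
      exact congrArg (fun k => k y) hh
    refine ⟨((LinearMap.ker g).liftQ h hle).comp
      (g.quotKerEquivOfSurjective hg).symm.toLinearMap, LinearMap.ext fun x => ?_⟩
    change (LinearMap.ker g).liftQ h hle ((g.quotKerEquivOfSurjective hg).symm (g x)) = h x
    have : (g.quotKerEquivOfSurjective hg).symm (g x) = (LinearMap.ker g).mkQ x := by
      rw [LinearEquiv.symm_apply_eq]
      rfl
    rw [this]
    simp
  · rintro ⟨k, rfl⟩
    refine LinearMap.ext fun x => ?_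
    change k (g (f x)) = 0
    rw [hfg.apply_apply_eq_zero, map_zero]

end Main

section Assembly

variable {R : Type} [Ring R] {S : Type} [Ring S]
variable {U : Type} [AddCommGroup U] [Module R U] [Module S U] [SMulCommClass R S U]
  [SMulCommClass S R U]
variable {K : ℕ → ModuleCat.{0} R} {m : ℕ → ℕ} (p : ∀ n, (Fin (m n) → R) →ₗ[R] ↥(K n))
  (i : ∀ n, ↥(K (n + 1)) →ₗ[R] (Fin (m n) → R))

/-- The dual of the `n`-th syzygy. -/
abbrev KD (S : Type) [Ring S] (U : Type) [AddCommGroup U] [Module R U] [Module S U]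
    [SMulCommClass R S U] (K : ℕ → ModuleCat.{0} R) (n : ℕ) : ModuleCat.{0} S :=
  ModuleCat.of S (↥(K n) →ₗ[R] U)

/-- The dual of the `n`-th free module. -/
abbrev PD (R : Type) [Ring R] (S : Type) [Ring S] (U : Type) [AddCommGroup U] [Module R U]
    [Module S U] [SMulCommClass R S U] (m : ℕ → ℕ) (n : ℕ) : ModuleCat.{0} S :=
  ModuleCat.of S ((Fin (m n) → R) →ₗ[R] U)

/-- The image of the dual of the `n`-th free module in the dual of the next syzygy. -/
abbrev IM (S : Type) [Ring S] (U : Type) [AddCommGroup U] [Module R U] [Module S U]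
    [SMulCommClass R S U] (i : ∀ n, ↥(K (n + 1)) →ₗ[R] (Fin (m n) → R)) (n : ℕ) :
    ModuleCat.{0} S :=
  ModuleCat.of S ↥(LinearMap.range (precompS R S U (i n)))

/-- `K_n^* → P_n^*` -/
abbrev aa (S : Type) [Ring S] (U : Type) [AddCommGroup U] [Module R U] [Module S U]
    [SMulCommClass R S U] (p : ∀ n, (Fin (m n) → R) →ₗ[R] ↥(K n)) (n : ℕ) :
    ↥(KD S U K n) →ₗ[S] ↥(PD R S U m n) := precompS R S U (p n)

/-- `P_n^* → I_n` -/
abbrev bb (S : Type) [Ring S] (U : Type) [AddCommGroup U] [Module R U] [Module S U]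
    [SMulCommClass R S U] (i : ∀ n, ↥(K (n + 1)) →ₗ[R] (Fin (m n) → R)) (n : ℕ) :
    ↥(PD R S U m n) →ₗ[S] ↥(IM S U i n) := (precompS R S U (i n)).rangeRestrict

/-- `I_n → K_{n+1}^*` -/
abbrev cc (S : Type) [Ring S] (U : Type) [AddCommGroup U] [Module R U] [Module S U]
    [SMulCommClass R S U] (i : ∀ n, ↥(K (n + 1)) →ₗ[R] (Fin (m n) → R)) (n : ℕ) :
    ↥(IM S U i n) →ₗ[S] ↥(KD S U K (n + 1)) :=
  (LinearMap.range (precompS R S U (i n))).subtype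

variable (hi : ∀ n, Function.Injective (i n)) (hip : ∀ n, Function.Exact (i n) (p n))
  (hp : ∀ n, Function.Surjective (p n))

include hp in
lemma aa_inj (n : ℕ) : Function.Injective (aa S U p n) := precompS_injective R S U _ (hp n)

include hp hip in
lemma aa_bb (n : ℕ) : Function.Exact (aa S U p n) (bb S U i n) := by
  intro x
  rw [← precompS_exact R S U (i n) (p n) (hip n) (hp n) x]
  exact Subtype.ext_iff

lemma bb_surj (n : ℕ) : Function.Surjective (bb S U i n) := LinearMap.surjective_rangeRestrict _

lemma exact_mkQ {A B : Type} [AddCommGroup A] [Module R A] [AddCommGroup B] [Module R B]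
    (f : A →ₗ[R] B) : Function.Exact f (LinearMap.range f).mkQ := by
  intro x; simp

variable (hso : ∀ i, Subsingleton (EE S U (ModuleCat.of S U) (i + 1))) {g : ℕ}
  (hinj : ∀ (N : ModuleCat.{0} S) (j : ℕ), g < j → Subsingleton (EE S U N j))

include hp hso hinj in
lemma vanish_IM (n j : ℕ) (hj : g ≤ j + 1) : Subsingleton (EE S U (IM S U i n) (j + 1)) := by
  let f : ↥(IM S U i n) →ₗ[S] ↥(PD R S U m (n + 1)) := (aa S U p (n + 1)).comp (cc S U i n)
  refine vanishA U (B := PD R S U m (n + 1)) (C := ModuleCat.of S (_ ⧸ LinearMap.range f)) f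
    (LinearMap.range f).mkQ ?_ (exact_mkQ f) (Submodule.mkQ_surjective _)
    (vanish_dual R S U hso _ _) (hinj _ _ (by omega))
  exact (aa_inj p hp (n + 1)).comp (Submodule.subtype_injective _)

include hp hso hip hinj in
lemma vanish_KD (n j : ℕ) (hj : g ≤ j + 2) : Subsingleton (EE S U (KD S U K n) (j + 1)) :=
  vanishA U (aa S U p n) (bb S U i n) (aa_inj p hp n) (aa_bb p i hip hp n) (bb_surj i n)
    (vanish_dual R S U hso _ _) (vanish_IM p i hp hso hinj n (j + 1) (by omega))

include hi hip hp in
lemma EE_syz (n j : ℕ) : Nonempty (EE R U (K n) (j + 1) ≃ₗ[S] EE R U (K 0) (j + 1 + n)) := by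
  induction n generalizing j with
  | zero => exact ⟨LinearEquiv.refl _ _⟩
  | succ n ih =>
    obtain ⟨e⟩ := ih (j + 1)
    obtain ⟨e'⟩ := shiftIso S U (A := K (n + 1)) (B := ModuleCat.of R (Fin (m n) → R))
      (C := K n) (i n) (p n) (hi n) (hip n) (hp n)
      (n := j + 1) (vanish_proj R U _ _) (vanish_proj R U _ _)
    have h3 : j + 1 + 1 + n = j + 1 + (n + 1) := by omega
    rw [← h3]
    exact ⟨e'.trans e⟩

variable (hM : ∀ j < g, Subsingleton (EE R U (K 0) j))

include hi hip hp hM in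
lemma cc_bij (n : ℕ) (hn : n + 1 < g) : Function.Bijective (cc S U i n) := by
  refine ⟨Submodule.subtype_injective _, fun k => ?_⟩
  have h1 : Subsingleton (EE R U (K n) 1) := by
    obtain ⟨e⟩ := EE_syz (S := S) (U := U) p i hi hip hp n 0
    have := hM (0 + 1 + n) (by omega)
    exact e.toEquiv.subsingleton
  obtain ⟨h, hh⟩ := extendHom U (A := K (n + 1)) (B := ModuleCat.of R (Fin (m n) → R))
      (C := K n) (i n) (p n) (hi n) (hip n) (hp n) h1 k
  exact ⟨⟨k, h, hh⟩, rfl⟩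

include hip hp hM in
lemma bb_bij (hg : 0 < g) : Function.Bijective (bb S U i 0) := by
  refine ⟨?_, bb_surj i 0⟩
  have h0 : Subsingleton (↥(K 0) →ₗ[R] U) := by
    have := hM 0 hg
    exact (homEE R S U (K 0)).toEquiv.subsingleton
  rw [← LinearMap.ker_eq_bot, LinearMap.ker_eq_bot']
  intro x hx
  obtain ⟨y, rfl⟩ := (aa_bb p i hip hp 0 x).1 hx
  have : y = 0 := Subsingleton.elim (α := (↥(K 0) →ₗ[R] U)) _ _
  rw [this, map_zero]

variable (hb1 : ∀ φ : U →ₗ[S] U, ∃ a : R, ∀ u, φ u = a • u)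
    (hb2 : ∀ a : R, (∀ u : U, a • u = 0) → a = 0)

include hip hp in
lemma exact_d : Function.Exact ((i 0).comp (p 1)) (p 0) := by
  intro x
  rw [hip 0 x]
  constructor
  · rintro ⟨y, rfl⟩
    obtain ⟨z, rfl⟩ := hp 1 y
    exact ⟨z, rfl⟩
  · rintro ⟨z, rfl⟩
    exact ⟨p 1 z, rfl⟩

include hi hip hp hM hb1 hb2 hso in
lemma chain (n : ℕ) (hn : n + 1 < g) :
    Nonempty (↥(K 0) ≃ₗ[R] EE S U (IM S U i (n + 1)) (n + 1)) := by
  induction n with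
  | zero =>
    obtain ⟨e⟩ := shift0 R U (aa S U p 1) (bb S U i 1) (aa_inj p hp 1) (aa_bb p i hip hp 1)
      (bb_surj i 1) (vanish_dual R S U hso _ _)
    let E : ((Fin (m 0) → R) →ₗ[R] U) ≃ₗ[S] (↥(K 1) →ₗ[R] U) :=
      (LinearEquiv.ofBijective _ (bb_bij (S := S) (U := U) p i hip hp hM (by omega))).trans
        (LinearEquiv.ofBijective _ (cc_bij (S := S) (U := U) p i hi hip hp hM 0 hn))
    obtain ⟨e2⟩ := recog R S U hb1 hb2 ((i 0).comp (p 1)) (p 0) (exact_d p i hip hp) (hp 0) E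
      (LinearMap.range (precompS S R U (aa S U p 1))).mkQ (Submodule.mkQ_surjective _) (by
        intro h
        rw [← LinearMap.mem_ker, Submodule.ker_mkQ, LinearMap.mem_range]
        refine exists_congr fun k => ?_
        constructor
        · rintro rfl f
          rfl
        · intro hk
          refine LinearMap.ext fun x => ?_
          obtain ⟨f, rfl⟩ := E.surjective x
          exact hk f)
    exact ⟨e2.trans e⟩
  | succ n ih =>
    obtain ⟨e⟩ := ih (by omega)
    obtain ⟨e2⟩ := shiftIso R U (aa S U p (n + 2)) (bb S U i (n + 2)) (aa_inj p hp _)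
      (aa_bb p i hip hp _) (bb_surj i _) (n := n + 1) (vanish_dual R S U hso _ _)
      (vanish_dual R S U hso _ _)
    have e3 := isoEE S R U (A := IM S U i (n + 1)) (B := KD S U K (n + 2))
      (LinearEquiv.ofBijective _ (cc_bij (S := S) (U := U) p i hi hip hp hM (n + 1) hn)) (n + 1)
    exact ⟨e.trans (e3.symm.trans e2)⟩

include hi hip hp hM hb1 hb2 hso hinj in
lemma final_pos (hg : 0 < g) (E : ModuleCat.{0} S) (eE : ↥E ≃ₗ[S] EE R U (K 0) g) :
    Nonempty (↥(K 0) ≃ₗ[R] EE S U E g) := by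
  obtain ⟨n, rfl⟩ : ∃ n, g = n + 1 := ⟨g - 1, by omega⟩
  obtain ⟨e1⟩ := shift0 S U (A := K (n + 1)) (B := ModuleCat.of R (Fin (m n) → R))
      (C := K n) (i n) (p n) (hi n) (hip n) (hp n) (vanish_proj R U _ _)
  obtain ⟨e2⟩ := EE_syz (S := S) (U := U) p i hi hip hp n 0
  have h3 : 0 + 1 + n = n + 1 := by omega
  rw [h3] at e2
  let Q : ModuleCat.{0} S :=
    ModuleCat.of S ((↥(K (n + 1)) →ₗ[R] U) ⧸ LinearMap.range (precompS R S U (i n)))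
  let eQ : ↥Q ≃ₗ[S] ↥E := (e1.trans e2).trans eE.symm
  have e4 := isoEE S R U eQ (n + 1)
  have hcc : Function.Exact (cc S U i n) (LinearMap.range (precompS R S U (i n))).mkQ := by
    intro x; simp
  have hV := vanish_KD (S := S) (U := U) p i hip hp hso hinj (n + 1)
  cases n with
  | zero =>
    obtain ⟨e⟩ := shift0 R U (C := Q) (cc S U i 0) (LinearMap.range (precompS R S U (i 0))).mkQ
      (Submodule.subtype_injective _) hcc (Submodule.mkQ_surjective _) (hV 0 (by omega))
    obtain ⟨e5⟩ := recog R S U hb1 hb2 ((i 0).comp (p 1)) (p 0) (exact_d p i hip hp) (hp 0)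
      (LinearEquiv.ofBijective _ (bb_bij (S := S) (U := U) p i hip hp hM (by omega)))
      (LinearMap.range (precompS S R U (cc S U i 0))).mkQ (Submodule.mkQ_surjective _) (by
        intro h
        rw [← LinearMap.mem_ker, Submodule.ker_mkQ, LinearMap.mem_range]
        constructor
        · rintro ⟨k, rfl⟩
          obtain ⟨k', hk'⟩ := extendHom U (aa S U p 1) (bb S U i 1) (aa_inj p hp 1)
            (aa_bb p i hip hp 1) (bb_surj i 1)
            (vanish_IM (S := S) (U := U) p i hp hso hinj 1 0 (by omega)) k
          refine ⟨k', fun f => ?_⟩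
          rw [← hk']
          rfl
        · rintro ⟨k, hk⟩
          refine ⟨k.comp (aa S U p 1), LinearMap.ext fun x => ?_⟩
          obtain ⟨f, rfl⟩ := bb_surj i 0 x
          exact hk f)
    exact ⟨e5.trans (e.trans e4.symm)⟩
  | succ n =>
    obtain ⟨e⟩ := shiftIso R U (C := Q) (cc S U i (n + 1))
      (LinearMap.range (precompS R S U (i (n + 1)))).mkQ
      (Submodule.subtype_injective _) hcc (Submodule.mkQ_surjective _) (n := n + 1)
      (hV n (by omega)) (hV (n + 1) (by omega))
    obtain ⟨e5⟩ := chain (S := S) (U := U) p i hi hip hp hso hM hb1 hb2 n (by omega)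
    exact ⟨e5.trans (e.trans e4.symm)⟩

include hip hp hb1 hb2 hso in
lemma final_zero (hinj : ∀ (N : ModuleCat.{0} S) (j : ℕ), 0 < j → Subsingleton (EE S U N j))
    (E : ModuleCat.{0} S) (eE : ↥E ≃ₗ[S] EE R U (K 0) 0) :
    Nonempty (↥(K 0) ≃ₗ[R] EE S U E 0) := by
  let eQ : ↥(KD S U K 0) ≃ₗ[S] ↥E := (homEE R S U (K 0)).trans eE.symm
  have e4 := isoEE S R U eQ 0
  have e5 := homEE S R U (KD S U K 0)
  have hI := vanish_IM (S := S) (U := U) p i hp hso hinj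
  obtain ⟨e⟩ := recog R S U hb1 hb2 ((i 0).comp (p 1)) (p 0) (exact_d p i hip hp) (hp 0)
      (LinearEquiv.refl S _) (precompS S R U (aa S U p 0))
      (fun k => extendHom U (aa S U p 0) (bb S U i 0) (aa_inj p hp 0)
            (aa_bb p i hip hp 0) (bb_surj i 0) (hI 0 0 (by omega)) k) (by
        intro h
        constructor
        · intro hh
          obtain ⟨k, rfl⟩ := (precompS_exact S R U (aa S U p 0) (bb S U i 0)
            (aa_bb p i hip hp 0) (bb_surj i 0) h).1 hh
          let f : ↥(IM S U i 0) →ₗ[S] ↥(PD R S U m 1) := (aa S U p 1).comp (cc S U i 0)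
          obtain ⟨k', rfl⟩ := extendHom U (B := PD R S U m 1)
            (C := ModuleCat.of S (_ ⧸ LinearMap.range f)) f
            (LinearMap.range f).mkQ ((aa_inj p hp 1).comp (Submodule.subtype_injective _))
            (exact_mkQ f) (Submodule.mkQ_surjective _) (hinj _ _ (by omega)) k
          exact ⟨k', fun _ => rfl⟩
        · rintro ⟨k, hk⟩
          refine LinearMap.ext fun x => ?_
          have := hk (aa S U p 0 x)
          refine Eq.trans this.symm ?_
          have h0 : precompS R S U ((i 0).comp (p 1)) (aa S U p 0 x) = 0 := by
            refine LinearMap.ext fun y => ?_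
            change x (p 0 (i 0 (p 1 y))) = 0
            rw [(hip 0).apply_apply_eq_zero, map_zero]
          rw [h0, map_zero]
          rfl)
  exact ⟨e.trans (e5.trans e4.symm)⟩

end Assembly

section Statement

variable (Λ Γ : Type) [Ring Λ] [Ring Γ]
  [IsNoetherianRing Λ] [IsNoetherianRing Λᵐᵒᵖ]
  [IsNoetherianRing Γ] [IsNoetherianRing Γᵐᵒᵖ]
variable (U : Type) [AddCommGroup U] [Module Λ U] [Module Γᵐᵒᵖ U]
  [SMulCommClass Λ Γᵐᵒᵖ U] [SMulCommClass Γᵐᵒᵖ Λ U]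
  [Module.Finite Λ U] [Module.Finite Γᵐᵒᵖ U]

/-- **Theorem 4.1(1).** Let `U` be a Gorenstein bimodule with `r.id_Γ(U) = g`. Then every
nonzero `M ∈ mod Λ` with `grade_U M = g` satisfies `M ≅ Ext^g_Γ(Ext^g_Λ(M,U),U)`. -/
theorem double_ext_iso_of_gradeEq (g : ℕ)
    (hfb : FaithfullyBalanced Λ Γ U) (hso : SelfOrthogonal Λ Γ U)
    (hgor : ∀ k, LeftGorenstein Λ Γ U k ∧ RightGorenstein Λ Γ U k)
    (hrid : injDim Γᵐᵒᵖ (ModuleCat.of Γᵐᵒᵖ U) = (g : ℕ∞))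
    (M : ModuleCat.{0} Λ) (hMfg : Module.Finite Λ ↥M) (hM0 : Nontrivial ↥M)
    (hMg : gradeEq Λ Γᵐᵒᵖ U M g) :
    Nonempty (↥M ≃ₗ[Λ] ExtU Γᵐᵒᵖ Λ U (ModuleCat.of Γᵐᵒᵖ (ExtU Λ Γᵐᵒᵖ U M g)) g) := by
  have hle : injDimLE Γᵐᵒᵖ g (ModuleCat.of Γᵐᵒᵖ U) := by
    unfold injDim at hrid
    have hne : {c : ℕ∞ | ∃ n : ℕ, c = n ∧ injDimLE Γᵐᵒᵖ n (ModuleCat.of Γᵐᵒᵖ U)}.Nonempty := by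
      by_contra h
      rw [Set.not_nonempty_iff_eq_empty] at h
      rw [h, sInf_empty] at hrid
      exact ENat.coe_ne_top g hrid.symm
    obtain ⟨n, hn, h⟩ := csInf_mem hne
    rw [hrid] at hn
    have : g = n := by exact_mod_cast hn
    rw [this]
    exact h
  have hinj : ∀ (N : ModuleCat.{0} Γᵐᵒᵖ) (j : ℕ), g < j → Subsingleton (EE Γᵐᵒᵖ U N j) :=
    fun N j hj => vanish_injDim Γᵐᵒᵖ U hle N j hj
  have hso' : ∀ i, Subsingleton (EE Γᵐᵒᵖ U (ModuleCat.of Γᵐᵒᵖ U) (i + 1)) := fun i => by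
    obtain ⟨e⟩ := bridge Γᵐᵒᵖ Λ U (ModuleCat.of Γᵐᵒᵖ U) (i + 1)
    have : Subsingleton (ExtU Γᵐᵒᵖ Λ U (ModuleCat.of Γᵐᵒᵖ U) (i + 1)) :=
      hso.2 (i + 1) (by omega)
    exact e.symm.toEquiv.subsingleton
  have hb1 : ∀ φ : U →ₗ[Γᵐᵒᵖ] U, ∃ a : Λ, ∀ u, φ u = a • u := fun φ => by
    obtain ⟨a, rfl⟩ := hfb.1.2 φ
    exact ⟨a, fun _ => rfl⟩
  have hb2 : ∀ a : Λ, (∀ u : U, a • u = 0) → a = 0 := fun a ha => by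
    refine hfb.1.1 (LinearMap.ext fun u => ?_)
    change a • u = (0 : Λ) • u
    rw [ha, zero_smul]
  have hM : ∀ j < g, Subsingleton (EE Λ U M j) := fun j hj => by
    obtain ⟨e⟩ := bridge Λ Γᵐᵒᵖ U M j
    have : Subsingleton (ExtU Λ Γᵐᵒᵖ U M j) := hMg.1 j hj
    exact e.symm.toEquiv.subsingleton
  obtain ⟨K, m, p, i, rfl, hi, hip, hp⟩ := exists_res Λ M hMfg
  obtain ⟨eE⟩ := bridge Λ Γᵐᵒᵖ U (K 0) g
  obtain ⟨e2⟩ := bridge Γᵐᵒᵖ Λ U (ModuleCat.of Γᵐᵒᵖ (ExtU Λ Γᵐᵒᵖ U (K 0) g)) g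
  rcases Nat.eq_zero_or_pos g with hg | hg
  · subst hg
    obtain ⟨e⟩ := final_zero (S := Γᵐᵒᵖ) (U := U) p i hip hp hso' hb1 hb2 hinj
      (ModuleCat.of Γᵐᵒᵖ (ExtU Λ Γᵐᵒᵖ U (K 0) 0)) eE
    exact ⟨e.trans e2.symm⟩
  · obtain ⟨e⟩ := final_pos (S := Γᵐᵒᵖ) (U := U) p i hi hip hp hso' hinj hM hb1 hb2 hg
      (ModuleCat.of Γᵐᵒᵖ (ExtU Λ Γᵐᵒᵖ U (K 0) g)) eE
    exact ⟨e.trans e2.symm⟩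

end Statement

end GorPaper
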